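/- arXiv:1910.04141 — 4 statements merged into one kernel-verified Lean document; each statement's English description precedes it below -/
import Mathlib

section
/- Let I and K be types, and suppose I contains two distinct elements. Let B denote the free group on the type I ⊕ K, and let A denote the subgroup of B generated by the generators indexed by I (equivalently, A is the range of the homomorphism from the free group on I to B induced by the left inclusion I → I ⊕ K). If b ∈ B satisfies b a b⁻¹ = a for every a ∈ A, then b is the identity element of B. -/
/-- If `b` commutes with the generator `x`, the first letter of the reduced word of `b` is
`x` or `x⁻¹`. -/
theorem FreeGroup.fst_eq_of_commute_of {α : Type*} [DecidableEq α] {b : FreeGroup α} {x : α}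
    (h : Commute b (FreeGroup.of x)) {p : α × Bool} {L : List (α × Bool)}
    (hp : b.toWord = p :: L) : p.1 = x := by
  by_contra hne
  have hred : FreeGroup.IsReduced (p :: L) := hp ▸ FreeGroup.isReduced_toWord
  have hcons : FreeGroup.IsReduced ((x, true) :: p :: L) :=
    FreeGroup.isReduced_cons_cons.2 ⟨fun hx => absurd hx.symm hne, hred⟩
  have hword : (b * FreeGroup.of x).toWord = (x, true) :: p :: L := by
    rw [h.eq, FreeGroup.toWord_mul, FreeGroup.toWord_of, hp, List.singleton_append,
      hcons.reduce_eq]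
  have hsub := FreeGroup.toWord_mul_sublist b (FreeGroup.of x)
  rw [hword, hp, FreeGroup.toWord_of] at hsub
  have heq := hsub.eq_of_length (by simp)
  rw [List.cons_append, List.cons.injEq] at heq
  exact hne (congrArg Prod.fst heq.1).symm

/-- Let `B` be the free group on `I ⊕ K`, where `I` has two distinct elements, and let `A`
be the subgroup generated by the generators indexed by `I` (the range of the homomorphism
`FreeGroup I →* FreeGroup (I ⊕ K)` induced by `Sum.inl`).  If `b` centralizes `A`, then
`b = 1`. -/
theorem eq_one_of_conj_fixes_subgroup {I K : Type*} (i₁ i₂ : I) (hI : i₁ ≠ i₂)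
    (b : FreeGroup (I ⊕ K))
    (hb : ∀ a ∈ (FreeGroup.map (Sum.inl : I → I ⊕ K)).range, b * a * b⁻¹ = a) :
    b = 1 := by
  classical
  have hcomm (i : I) : Commute b (FreeGroup.of (Sum.inl i)) :=
    mul_inv_eq_iff_eq_mul.1 (hb _ ⟨FreeGroup.of i, FreeGroup.map.of⟩)
  rcases hw : b.toWord with _ | ⟨p, L⟩
  · exact FreeGroup.toWord_eq_nil_iff.1 hw
  · exact absurd (Sum.inl_injective ((FreeGroup.fst_eq_of_commute_of (hcomm i₁) hw).symm.trans
      (FreeGroup.fst_eq_of_commute_of (hcomm i₂) hw))) hI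
end

section
/- Let I and K be types, and suppose I contains two distinct elements. Let B denote the free group on the type I ⊕ K, and let A denote the subgroup of B generated by the generators indexed by I (equivalently, A is the range of the homomorphism from the free group on I to B induced by the left inclusion I → I ⊕ K). If b ∈ B and a ∈ A satisfy b a b⁻¹ ∈ A, then either a is the identity element or b ∈ A. -/
namespace FreeGroup

variable {α β : Type*}

/-- The product of a word whose letters are indexed by the range of `f` lies in the range of
`FreeGroup.map f`. -/
theorem mk_mem_range_map (f : α → β) {L : List (β × Bool)} (h : ∀ y ∈ L, y.1 ∈ Set.range f) :
    mk L ∈ (map f).range := by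
  induction L with
  | nil => exact one_mem _
  | cons y L ih =>
    obtain ⟨x, hx⟩ := h y List.mem_cons_self
    have hy : mk [y] ∈ (map f).range := ⟨mk [(x, y.2)], by simp [hx]⟩
    simpa [mul_mk] using mul_mem hy (ih fun z hz => h z (List.mem_cons_of_mem _ hz))

/-- The reduced word of an element of the range of `FreeGroup.map f` only has letters indexed by
the range of `f`. -/
theorem fst_mem_range_of_mem_toWord [DecidableEq β] {f : α → β} {x : FreeGroup β}
    (hx : x ∈ (map f).range) {y : β × Bool} (hy : y ∈ x.toWord) : y.1 ∈ Set.range f := by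
  obtain ⟨c, rfl⟩ := hx
  obtain ⟨L, rfl⟩ := Quot.exists_rep c
  have hy' : y ∈ reduce (L.map fun z => (f z.1, z.2)) := hy
  obtain ⟨z, -, rfl⟩ := List.mem_map.1 (reduce.red.sublist.subset hy')
  exact ⟨z.1, rfl⟩

/-- Conjugating a nonempty reduced word `L` by a reduced word ending in `x` causes no cancellation
if the generator underlying `x` does not occur in `L`. -/
theorem IsReduced.conj {w L : List (β × Bool)} {x : β × Bool} (hw : IsReduced (w ++ [x]))
    (hL : IsReduced L) (hne : L ≠ []) (hx : ∀ y ∈ L, y.1 ≠ x.1) :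
    IsReduced (w ++ [x] ++ L ++ invRev (w ++ [x])) := by
  classical
  have hinv : IsReduced (invRev (w ++ [x])) := by
    rw [isReduced_iff_reduce_eq, reduce_invRev, hw.reduce_eq]
  refine IsReduced.append_overlap ?_ ?_ hne
  · refine List.isChain_append.2 ⟨hw, hL, fun a ha b hb hab => ?_⟩
    obtain rfl : x = a := by simpa using ha
    exact absurd hab.symm (hx b (List.mem_of_mem_head? hb))
  · refine List.isChain_append.2 ⟨hL, hinv, fun a ha b hb hab => ?_⟩
    obtain rfl : (x.1, !x.2) = b := by simpa [invRev] using hb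
    exact absurd hab (hx a (List.mem_of_mem_getLast? ha))

/-- The subgroup generated by a set of generators of a free group is malnormal. -/
theorem mem_range_map_of_conj_mem (f : α → β) {a b : FreeGroup β} (ha : a ∈ (map f).range)
    (ha₁ : a ≠ 1) (hab : b * a * b⁻¹ ∈ (map f).range) : b ∈ (map f).range := by
  classical
  suffices H : ∀ w : List (β × Bool), IsReduced w → ∀ a ∈ (map f).range, a ≠ 1 →
      mk w * a * (mk w)⁻¹ ∈ (map f).range → mk w ∈ (map f).range by
    simpa only [mk_toWord] using H b.toWord isReduced_toWord a ha ha₁ (by simpa only [mk_toWord])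
  intro w
  induction w using List.reverseRecOn with
  | nil => exact fun _ _ _ _ _ => one_mem _
  | append_singleton w x ih =>
    intro hw a ha ha₁ hab
    by_cases hx : x.1 ∈ Set.range f
    · have hxA : mk [x] ∈ (map f).range := mk_mem_range_map f (by simpa using hx)
      rw [← mul_mk] at hab ⊢
      refine mul_mem (ih (hw.infix (List.prefix_append _ _).isInfix) (mk [x] * a * (mk [x])⁻¹)
        (mul_mem (mul_mem hxA ha) (inv_mem hxA)) (mt conj_eq_one_iff.1 ha₁) ?_) hxA
      simpa only [mul_inv_rev, mul_assoc] using hab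
    · have hred := hw.conj (isReduced_toWord (x := a)) (by simpa using ha₁)
        fun y hy hyx => hx (hyx ▸ fst_mem_range_of_mem_toWord ha hy)
      have hword : (mk (w ++ [x]) * a * (mk (w ++ [x]))⁻¹).toWord =
          w ++ [x] ++ a.toWord ++ invRev (w ++ [x]) := by
        rw [← hred.reduce_eq, ← toWord_mk, ← mul_mk (L₂ := invRev _), ← mul_mk (L₂ := a.toWord),
          mk_toWord, inv_mk]
      exact absurd (fst_mem_range_of_mem_toWord hab (y := x) (by rw [hword]; simp)) hx

end FreeGroup

/-- Let `B` be the free group on `I ⊕ K`, where `I` has two distinct elements, and let `A`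
be the subgroup generated by the generators indexed by `I` (the range of the homomorphism
`FreeGroup I →* FreeGroup (I ⊕ K)` induced by `Sum.inl`).  If `b a b⁻¹ ∈ A` for some
`a ∈ A`, then either `a = 1` or `b ∈ A`. -/
theorem eq_one_or_mem_of_conj_mem {I K : Type*} (i₁ i₂ : I) (hI : i₁ ≠ i₂)
    (a b : FreeGroup (I ⊕ K))
    (ha : a ∈ (FreeGroup.map (Sum.inl : I → I ⊕ K)).range)
    (hab : b * a * b⁻¹ ∈ (FreeGroup.map (Sum.inl : I → I ⊕ K)).range) :
    a = 1 ∨ b ∈ (FreeGroup.map (Sum.inl : I → I ⊕ K)).range :=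
  or_iff_not_imp_left.2 fun ha₁ => FreeGroup.mem_range_map_of_conj_mem _ ha ha₁ hab
end

section
/- Let J be a type, let u and v be elements of the free group on J, and let j ∈ J. Suppose that neither the generator j nor its inverse occurs as a letter in the reduced word of u, and that j occurs (with some sign) as a letter in the reduced word of v. Then j occurs (with some sign) as a letter in the reduced word of the product u * v, and likewise in the reduced word of v * u. -/
/-- A generator occurring in `(x * y).toWord` occurs in `x.toWord` or in `y.toWord`. -/
theorem exists_mem_toWord_or_of_mul {J : Type*} [DecidableEq J] {x y : FreeGroup J} {j : J}
    (h : ∃ s : Bool, (j, s) ∈ (x * y).toWord) :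
    (∃ s : Bool, (j, s) ∈ x.toWord) ∨ ∃ s : Bool, (j, s) ∈ y.toWord := by
  obtain ⟨s, hs⟩ := h
  exact (List.mem_append.mp ((FreeGroup.toWord_mul_sublist x y).subset hs)).imp
    (fun h => ⟨s, h⟩) (fun h => ⟨s, h⟩)

/-- A generator occurring in the reduced word of `x⁻¹` occurs in the reduced word of `x`. -/
theorem exists_mem_toWord_of_inv {J : Type*} [DecidableEq J] {x : FreeGroup J} {j : J}
    (h : ∃ s : Bool, (j, s) ∈ x⁻¹.toWord) : ∃ s : Bool, (j, s) ∈ x.toWord := by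
  obtain ⟨s, hs⟩ := h
  simp only [FreeGroup.toWord_inv, FreeGroup.invRev, List.mem_reverse, List.mem_map,
    Prod.mk.injEq] at hs
  obtain ⟨⟨i, t⟩, hmem, rfl, -⟩ := hs
  exact ⟨t, hmem⟩

/-- If the generator `j` occurs with neither sign in the reduced word of `u` and occurs
(with some sign) in the reduced word of `v`, then `j` occurs (with some sign) in the
reduced words of both `u * v` and `v * u`. -/
theorem mem_toWord_mul_of_mem {J : Type*} [DecidableEq J] (u v : FreeGroup J) (j : J)
    (hu : ∀ s : Bool, (j, s) ∉ u.toWord) (hv : ∃ s : Bool, (j, s) ∈ v.toWord) :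
    (∃ s : Bool, (j, s) ∈ (u * v).toWord) ∧ (∃ s : Bool, (j, s) ∈ (v * u).toWord) := by
  have hu' : ¬ ∃ s : Bool, (j, s) ∈ u⁻¹.toWord := fun h =>
    (exists_mem_toWord_of_inv h).elim hu
  constructor
  · rw [← inv_mul_cancel_left u v] at hv
    exact (exists_mem_toWord_or_of_mul hv).resolve_left hu'
  · rw [← mul_inv_cancel_right v u] at hv
    exact (exists_mem_toWord_or_of_mul hv).resolve_right hu'
end

section
/- Let X be a topological space, x ∈ X, and let n ≥ 0 and k ≥ 2 be natural numbers. Let C(Sⁿ, X) denote the space of continuous maps from the unit sphere Sⁿ in ℝ^{n+1} to X, equipped with the compact-open topology, and let const_x ∈ C(Sⁿ, X) denote the constant map at x. Then there is a group isomorphism from π_k(C(Sⁿ, X), const_x) to the direct product π_{n+k}(X, x) × π_k(X, x). -/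
open Topology

open scoped unitInterval

/-- A deformation `r` of `S` fixing `s₀`, together with a height function, such that `r` collapses
to `s₀` the region of nonnegative height, which reaches height `1` at time `1` over `s₀`. -/
structure PointSqueeze (S : Type*) [TopologicalSpace S] (s₀ : S) where
  r : I × S → S
  height : I × S → ℝ
  continuous_r : Continuous r
  continuous_height : Continuous height
  r_zero : ∀ s, r (0, s) = s
  r_base : ∀ t, r (t, s₀) = s₀
  r_of_nonneg : ∀ p, 0 ≤ height p → r p = s₀
  height_zero : ∀ s, height (0, s) ≤ 0
  height_one : height (1, s₀) = 1

/-- The space of based maps `(S, s₀) → (B, b)`. -/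
abbrev BasedMap (S : Type*) [TopologicalSpace S] (s₀ : S) (B : Type*) [TopologicalSpace B]
    (b : B) : Type _ :=
  {f : C(S, B) // f s₀ = b}

section Lifting

variable {S : Type*} [TopologicalSpace S] [LocallyCompactSpace S] {s₀ : S}
  {B : Type*} [TopologicalSpace B]

/-- Weak homotopy lifting for the evaluation map `C(S, B) → B` at `s₀`. -/
theorem PointSqueeze.exists_lift (R : PointSqueeze S s₀) {Y : Type*} [TopologicalSpace Y]
    (F : C(Y, C(S, B))) (h : C(I × Y, B)) (hF : ∀ y, h (0, y) = F y s₀) :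
    ∃ H : C(I × Y, C(S, B)), (∀ y, H (0, y) = F y) ∧ (∀ y, H (1, y) s₀ = h (1, y)) ∧
      (∀ v y, ∃ t, H (v, y) s₀ = h (t, y)) ∧
      ∀ y b, F y = .const S b → (∀ t, h (t, y) = b) → ∀ v, H (v, y) = .const S b := by
  let G : (I × Y) × S → B := fun p ↦ if R.height (p.1.1, p.2) ≤ 0
    then F p.1.2 (R.r (p.1.1, p.2))
    else h (Set.projIcc 0 1 zero_le_one (R.height (p.1.1, p.2)), p.1.2)
  have hr := R.continuous_r
  have hh := R.continuous_height
  have hG : Continuous G := by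
    refine Continuous.if_le ?_ ?_ (by fun_prop) continuous_const ?_
    · have : Continuous fun q : Y × S ↦ F q.1 q.2 :=
        ContinuousMap.continuous_uncurry_of_continuous F
      exact this.comp (f := fun p : (I × Y) × S ↦ (p.1.2, R.r (p.1.1, p.2))) (by fun_prop)
    · have := continuous_projIcc (a := (0 : ℝ)) (b := 1) (h := zero_le_one)
      fun_prop
    · rintro ⟨⟨t, y⟩, s⟩ hp
      simp only at hp ⊢
      rw [R.r_of_nonneg _ hp.ge, hp, Set.projIcc_left, ← hF]
      rfl
  refine ⟨(⟨G, hG⟩ : C(_, _)).curry, fun y ↦ ?_, fun y ↦ ?_, fun v y ↦ ?_, fun y b hb hc v ↦ ?_⟩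
  · ext s
    simp [G, R.height_zero, R.r_zero]
  · simp [G, R.height_one]
  · by_cases hv : R.height (v, s₀) ≤ 0
    · exact ⟨0, by simp [G, hv, R.r_base, hF]⟩
    · exact ⟨Set.projIcc 0 1 zero_le_one (R.height (v, s₀)), by simp [G, hv]⟩
  · ext s
    simp [G, hb, hc]

end Lifting

theorem Path.homotopic_of_continuousMap {X : Type*} [TopologicalSpace X] {x y : X} {p q : Path x y}
    (H : C(I × I, X)) (h₀ : ∀ t, H (0, t) = p t) (h₁ : ∀ t, H (1, t) = q t)
    (hx : ∀ u, H (u, 0) = x) (hy : ∀ u, H (u, 1) = y) : p.Homotopic q :=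
  ⟨{ toContinuousMap := H
     map_zero_left := h₀
     map_one_left := h₁
     prop' := by
      rintro u t (rfl | rfl)
      · simpa using hx u
      · simpa using hy u }⟩

namespace FundamentalGroup

variable {X Y Z : Type*} [TopologicalSpace X] [TopologicalSpace Y] [TopologicalSpace Z]
  {x : X} {y : Y} {z : Z}

theorem mapOfEq_mk (f : C(X, Y)) (h : f x = y) (p : Path x x) :
    mapOfEq f h (Path.Homotopic.Quotient.mk p) =
      Path.Homotopic.Quotient.mk ((p.map f.continuous).cast h.symm h.symm) :=
  mapOfEq_apply ..

theorem mapOfEq_comp_apply (f : C(X, Y)) (g : C(Y, Z)) (hf : f x = y) (hg : g y = z)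
    (p : FundamentalGroup X x) :
    mapOfEq g hg (mapOfEq f hf p) = mapOfEq (g.comp f) (by simp [hf, hg]) p := by
  induction p using Path.Homotopic.Quotient.ind with | mk p =>
  simp only [mapOfEq_mk]
  rfl

theorem mapOfEq_id_apply (f : C(X, X)) (hf : ∀ a, f a = a) (p : FundamentalGroup X x) :
    mapOfEq f (hf x) p = p := by
  induction p using Path.Homotopic.Quotient.ind with | mk p =>
  rw [mapOfEq_mk]
  congr 1
  ext t
  exact hf _

theorem mapOfEq_const_apply (f : C(X, Y)) (hf : ∀ a, f a = y) (p : FundamentalGroup X x) :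
    mapOfEq f (hf x) p = 1 := by
  induction p using Path.Homotopic.Quotient.ind with | mk p =>
  rw [mapOfEq_mk, one_def, ← Path.Homotopic.Quotient.mk_refl]
  congr 1
  ext t
  exact hf _

theorem mapOfEq_mk_eq_one_iff (f : C(X, Y)) (h : f x = y) (p : Path x x) :
    mapOfEq f h (Path.Homotopic.Quotient.mk p) = 1 ↔ ∃ K : C(I × I, Y), (∀ t, K (0, t) = f (p t)) ∧
      (∀ t, K (1, t) = y) ∧ (∀ u, K (u, 0) = y) ∧ ∀ u, K (u, 1) = y := by
  rw [mapOfEq_mk, one_def, ← Path.Homotopic.Quotient.mk_refl, Path.Homotopic.Quotient.eq]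
  constructor
  · rintro ⟨K⟩
    exact ⟨K.toContinuousMap, K.apply_zero, K.apply_one, K.source, K.target⟩
  · rintro ⟨K, h₀, h₁, hx, hy⟩
    exact Path.homotopic_of_continuousMap K h₀ h₁ hx hy

/-- A homeomorphism induces an isomorphism of fundamental groups. -/
noncomputable def congrOfHomeomorph (e : X ≃ₜ Y) (h : e x = y) :
    FundamentalGroup X x ≃* FundamentalGroup Y y where
  __ := mapOfEq (e : C(X, Y)) h
  invFun := mapOfEq (e.symm : C(Y, X)) (by simp [← h])
  left_inv p := (mapOfEq_comp_apply ..).trans (mapOfEq_id_apply _ (by simp) p)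
  right_inv p := (mapOfEq_comp_apply ..).trans (mapOfEq_id_apply _ (by simp) p)

end FundamentalGroup

theorem nonempty_mulEquiv_prod_of_split {G A C : Type*} [Group G] [Group A] [Group C]
    (i : A →* G) (c : C →* G) (e : G →* C) (hcomm : ∀ g g' : G, g * g' = g' * g)
    (hi : Function.Injective i) (ei : ∀ a, e (i a) = 1) (ec : ∀ a, e (c a) = a)
    (hker : ∀ g, e g = 1 → ∃ a, i a = g) : Nonempty (G ≃* A × C) := by
  let φ := i.noncommCoprod c fun _ _ ↦ hcomm _ _
  refine ⟨(MulEquiv.ofBijective φ ⟨?_, fun g ↦ ?_⟩).symm⟩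
  · rw [injective_iff_map_eq_one]
    rintro ⟨a, a'⟩ h
    replace h : i a * c a' = 1 := h
    have h' : a' = 1 := by simpa [ei, ec] using congrArg e h
    subst h'
    rw [map_one, mul_one] at h
    rw [Prod.mk_eq_one]
    exact ⟨(injective_iff_map_eq_one _).1 hi a h, rfl⟩
  · obtain ⟨a, ha⟩ := hker (g * (c (e g))⁻¹) (by simp [ec])
    exact ⟨(a, e g), show i a * c (e g) = g by simp [ha]⟩

section Splitting

open FundamentalGroup Path.Homotopic

variable {S : Type*} [TopologicalSpace S] {s₀ : S}
  {B : Type*} [TopologicalSpace B] (b : B)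

variable (S B) in
/-- The inclusion of `B` into `C(S, B)` as constant maps. -/
def constMap : C(B, C(S, B)) := ContinuousMap.const'

variable (B) in
/-- Evaluation at `s₀`. -/
def evalMap (s₀ : S) : C(C(S, B), B) := ⟨fun f ↦ f s₀, by fun_prop⟩

variable (s₀) in
/-- The inclusion of based maps into all maps. -/
def inclMap : C(BasedMap S s₀ B b, C(S, B)) := ⟨Subtype.val, continuous_subtype_val⟩

variable (S s₀) in
/-- The constant map as a based map. -/
def BasedMap.const : BasedMap S s₀ B b := ⟨.const S b, rfl⟩

theorem evalMap_const : evalMap B s₀ (.const S b) = b := rfl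

theorem inclMap_const : inclMap s₀ b (.const S s₀ b) = .const S b := rfl

theorem constMap_apply : constMap S B b = .const S b := rfl

variable [LocallyCompactSpace S]

theorem PointSqueeze.exists_mapOfEq_inclMap_eq (R : PointSqueeze S s₀)
    (g : FundamentalGroup C(S, B) (.const S b))
    (hg : mapOfEq (evalMap B s₀) (evalMap_const b) g = 1) :
    ∃ a : FundamentalGroup (BasedMap S s₀ B b) (.const S s₀ b),
      mapOfEq (inclMap s₀ b) (inclMap_const b) a = g := by
  induction g using Path.Homotopic.Quotient.ind with | mk p =>
  obtain ⟨K, K0, K1, Ks, Kt⟩ := (mapOfEq_mk_eq_one_iff _ (evalMap_const b) p).1 hg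
  obtain ⟨H, H0, H1, -, Hc⟩ := R.exists_lift p.toContinuousMap K K0
  have hs (v : I) : H (v, 0) = .const S b := Hc _ _ p.source (fun t ↦ Ks t) v
  have ht (v : I) : H (v, 1) = .const S b := Hc _ _ p.target (fun t ↦ Kt t) v
  have h1 (t : I) : H (1, t) s₀ = b := (H1 t).trans (K1 t)
  refine ⟨.mk ⟨⟨fun t ↦ ⟨H (1, t), h1 t⟩, by fun_prop⟩, Subtype.ext (hs 1), Subtype.ext (ht 1)⟩, ?_⟩
  refine (mapOfEq_mk _ (inclMap_const b) _).trans (Path.Homotopic.Quotient.eq.2 ?_)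
  exact (Path.homotopic_of_continuousMap H H0 (fun _ ↦ rfl) hs ht).symm

theorem PointSqueeze.injective_mapOfEq_inclMap (R : PointSqueeze S s₀) :
    Function.Injective (mapOfEq (inclMap s₀ b) (inclMap_const b)) := by
  rw [injective_iff_map_eq_one]
  intro a ha
  induction a using Path.Homotopic.Quotient.ind with | mk p =>
  obtain ⟨K, K0, K1, Ks, Kt⟩ := (mapOfEq_mk_eq_one_iff _ (inclMap_const b) p).1 ha
  replace K0 (t : I) : K (0, t) = (p t).1 := K0 t
  refine Path.Homotopic.Quotient.eq.2 (?_ : p.Homotopic (.refl _))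
  let P : ℝ → I := Set.projIcc 0 1 zero_le_one
  have hP : Continuous P := continuous_projIcc
  have P0 : P 0 = 0 := Set.projIcc_left _
  have P1 : P 1 = 1 := Set.projIcc_right _
  let F : C(I × I, C(S, B)) := ⟨fun y ↦ if (y.1 : ℝ) ≤ 1 / 2 then K (P (2 * y.1), y.2)
    else .const S (K (P (2 - 2 * y.1), y.2) s₀), by
      refine Continuous.if_le (by fun_prop) ?_ (by fun_prop) continuous_const ?_
      · exact ContinuousMap.continuous_const'.comp (by fun_prop)
      · rintro ⟨u, t⟩ hu
        simp only at hu ⊢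
        norm_num [hu, P1, K1]⟩
  let lam (u : I) : ℝ := min (2 * u) (2 - 2 * u)
  let h : C(I × (I × I), B) := ⟨fun w ↦ K (P ((1 - w.1) * lam w.2.1), w.2.2) s₀, by fun_prop⟩
  have Fh (y : I × I) : h (0, y) = F y s₀ := by
    by_cases hy : (y.1 : ℝ) ≤ 1 / 2
    · have : lam y.1 = 2 * y.1 := min_eq_left (by linarith)
      simp only [F, h, ContinuousMap.coe_mk, if_pos hy, this]
      simp
    · have : lam y.1 = 2 - 2 * y.1 := min_eq_right (by linarith)
      simp only [F, h, ContinuousMap.coe_mk, if_neg hy, this]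
      simp
  have lam0 : lam 0 = 0 := by simp [lam]
  have lam1 : lam 1 = 0 := by simp [lam]
  have hs (v u) : h (v, (u, 0)) = b := by simp [h, Ks]
  have ht (v u) : h (v, (u, 1)) = b := by simp [h, Kt]
  have hb (t : I) : K (0, t) s₀ = b := by rw [K0]; exact (p t).2
  have h0 (v t) : h (v, (0, t)) = b := by simp [h, lam0, P0, hb]
  have h1 (v t) : h (v, (1, t)) = b := by simp [h, lam1, P0, hb]
  have hv1 (y) : h (1, y) = b := by simp [h, P0, hb]
  have F0 (t) : F (0, t) = (p t).1 := by simp [F, P0, K0]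
  have F1 (t) : F (1, t) = .const S b := by norm_num [F, P0, hb]
  have Fs (u) : F (u, 0) = .const S b := by simp [F, Ks]
  have Ft (u) : F (u, 1) = .const S b := by simp [F, Kt]
  obtain ⟨H, H0, H1, H2, Hc⟩ := R.exists_lift F h Fh
  have Hs (v u) : H (v, (u, 0)) = .const S b := Hc _ _ (Fs u) (fun t ↦ hs t u) v
  have Ht (v u) : H (v, (u, 1)) = .const S b := Hc _ _ (Ft u) (fun t ↦ ht t u) v
  have H1b (y) : H (1, y) s₀ = b := (H1 y).trans (hv1 y)
  have Hvb (v t) : H (v, (0, t)) s₀ = b := by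
    obtain ⟨w, hw⟩ := H2 v (0, t)
    exact hw.trans (h0 w t)
  let q : Path (BasedMap.const S s₀ b) (BasedMap.const S s₀ b) :=
    ⟨⟨fun t ↦ ⟨H (1, (0, t)), H1b _⟩, by fun_prop⟩, Subtype.ext (Hs 1 0), Subtype.ext (Ht 1 0)⟩
  refine Path.Homotopic.trans (p₁ := q) ?_ ?_
  · exact Path.homotopic_of_continuousMap ⟨fun w ↦ ⟨H (w.1, (0, w.2)), Hvb _ _⟩, by fun_prop⟩
      (fun t ↦ Subtype.ext ((H0 _).trans (F0 t))) (fun _ ↦ rfl)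
      (fun u ↦ Subtype.ext (Hs u 0)) (fun u ↦ Subtype.ext (Ht u 0))
  · exact Path.homotopic_of_continuousMap ⟨fun y ↦ ⟨H (1, y), H1b _⟩, by fun_prop⟩
      (fun _ ↦ rfl) (fun t ↦ Subtype.ext (Hc _ _ (F1 t) (fun v ↦ h1 v t) 1))
      (fun u ↦ Subtype.ext (Hs 1 u)) (fun u ↦ Subtype.ext (Ht 1 u))

theorem PointSqueeze.nonempty_mulEquiv_prod (R : PointSqueeze S s₀)
    (hcomm : ∀ g g' : FundamentalGroup C(S, B) (.const S b), g * g' = g' * g) :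
    Nonempty (FundamentalGroup C(S, B) (.const S b) ≃*
      FundamentalGroup (BasedMap S s₀ B b) (.const S s₀ b) × FundamentalGroup B b) := by
  refine nonempty_mulEquiv_prod_of_split (mapOfEq (inclMap s₀ b) (inclMap_const b))
    (mapOfEq (constMap S B) (constMap_apply b)) (mapOfEq (evalMap B s₀) (evalMap_const b)) hcomm
    (R.injective_mapOfEq_inclMap b) (fun a ↦ ?_) (fun a ↦ ?_) (R.exists_mapOfEq_inclMap_eq b)
  · exact (mapOfEq_comp_apply ..).trans (mapOfEq_const_apply _ (fun f ↦ f.2) a)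
  · exact (mapOfEq_comp_apply ..).trans (mapOfEq_id_apply _ (fun f ↦ rfl) a)

end Splitting

section Sphere

open scoped RealInnerProductSpace

open Metric

variable {E : Type*} [NormedAddCommGroup E] [InnerProductSpace ℝ E]

/-- The dilation of the unit sphere by `κ` in the stereographic coordinate centred at `v`, before
normalization by `(1 + ⟪s, v⟫) + κ ^ 2 * (1 - ⟪s, v⟫)`. -/
noncomputable def sphereDilation (v : E) (κ : ℝ) (s : E) : E :=
  (2 * κ) • (s - ⟪s, v⟫ • v) + ((1 + ⟪s, v⟫) - κ ^ 2 * (1 - ⟪s, v⟫)) • v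

theorem norm_sphereDilation {v s : E} (hv : ‖v‖ = 1) (hs : ‖s‖ = 1) (κ : ℝ) :
    ‖sphereDilation v κ s‖ = (1 + ⟪s, v⟫) + κ ^ 2 * (1 - ⟪s, v⟫) := by
  have h := abs_le.1 (abs_real_inner_le_norm s v)
  rw [hs, hv, mul_one] at h
  have hD : 0 ≤ (1 + ⟪s, v⟫) + κ ^ 2 * (1 - ⟪s, v⟫) :=
    add_nonneg (by linarith) (mul_nonneg (sq_nonneg _) (by linarith))
  rw [← sq_eq_sq₀ (norm_nonneg _) hD, ← real_inner_self_eq_norm_sq, sphereDilation]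
  simp only [inner_add_left, inner_add_right, inner_smul_left, inner_smul_right, inner_sub_left,
    inner_sub_right, real_inner_self_eq_norm_sq, hv, hs, real_inner_comm s v, conj_trivial]
  ring

/-- The unit sphere admits a squeeze onto any of its points. -/
noncomputable def spherePointSqueeze (v : sphere (0 : E) 1) : PointSqueeze (sphere (0 : E) 1) v :=
  let a : sphere (0 : E) 1 → ℝ := fun s ↦ ⟪(s : E), v⟫
  let κ : I × sphere (0 : E) 1 → ℝ := fun p ↦ max 0 (1 - p.1 * (1 + a p.2))
  let D : I × sphere (0 : E) 1 → ℝ := fun p ↦ (1 + a p.2) + κ p ^ 2 * (1 - a p.2)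
  have hv : ‖(v : E)‖ = 1 := norm_eq_of_mem_sphere v
  have ha (s) : -1 ≤ a s ∧ a s ≤ 1 := by
    simpa [a, hv] using abs_le.1 (abs_real_inner_le_norm (s : E) (v : E))
  have hav : a v = 1 := by simp [a, hv]
  have hD (p) : 0 < D p := by
    obtain ⟨h₁, h₂⟩ := ha p.2
    rcases h₁.eq_or_lt with h | h
    · simp [D, κ, ← h]
    · exact add_pos_of_pos_of_nonneg (by linarith) (mul_nonneg (sq_nonneg _) (by linarith))
  have haux : Continuous a := by fun_prop
  have hκ : Continuous κ := by fun_prop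
  { r := fun p ↦ ⟨(D p)⁻¹ • sphereDilation (v : E) (κ p) p.2, by
      rw [mem_sphere_zero_iff_norm, norm_smul,
        norm_sphereDilation hv (norm_eq_of_mem_sphere p.2), norm_inv, Real.norm_of_nonneg (hD p).le]
      exact inv_mul_cancel₀ (hD p).ne'⟩
    height := fun p ↦ p.1 * (1 + a p.2) - 1
    continuous_r := by
      refine Continuous.subtype_mk (Continuous.smul ?_ ?_) _
      · exact Continuous.inv₀ (by fun_prop) fun p ↦ (hD p).ne'
      · unfold sphereDilation
        fun_prop
    continuous_height := by fun_prop
    r_zero := fun s ↦ by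
      ext1
      have h₁ : κ (0, s) = 1 := by simp [κ]
      have h₂ : D (0, s) = 2 := by
        simp only [D, h₁]
        ring
      simp only [h₁, h₂, sphereDilation]
      module
    r_base := fun t ↦ by
      ext1
      have h₂ : D (t, v) = 2 := by
        simp only [D, hav]
        ring
      have h₃ : ⟪(v : E), v⟫ = 1 := hav
      simp only [h₂, sphereDilation, h₃]
      module
    r_of_nonneg := fun p hp ↦ by
      ext1
      have h₁ : κ p = 0 := max_eq_left (by linarith)
      have h₂ : D p = 1 + ⟪(p.2 : E), v⟫ := by simp [D, h₁, a]
      have h₃ := (hD p).ne'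
      rw [h₂] at h₃
      simp only [h₁, h₂, sphereDilation]
      simp [smul_smul, inv_mul_cancel₀ h₃]
    height_zero := fun s ↦ by simp
    height_one := by
      simp only [hav]
      norm_num }

end Sphere

section Collapse

open Classical in
/-- The collapse map onto the one-point compactification of an open subspace. -/
noncomputable def openCollapse {U K : Type*} (j : U → K) (z : K) : OnePoint U :=
  if h : ∃ u, j u = z then ↑h.choose else OnePoint.infty

theorem openCollapse_apply {U K : Type*} {j : U → K} (hj : Function.Injective j) (u : U) :
    openCollapse j (j u) = u := by
  have h : ∃ u', j u' = j u := ⟨u, rfl⟩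
  rw [openCollapse, dif_pos h, hj h.choose_spec]

theorem openCollapse_of_notMem {U K : Type*} {j : U → K} {z : K} (hz : z ∉ Set.range j) :
    openCollapse j z = OnePoint.infty :=
  dif_neg hz

theorem continuous_openCollapse {U K : Type*} [TopologicalSpace U] [TopologicalSpace K]
    [T2Space K] {j : U → K} (hj : IsOpenEmbedding j) : Continuous (openCollapse j) := by
  refine continuous_def.2 fun s hs ↦ ?_
  by_cases h : OnePoint.infty ∈ s
  · have hc := ((OnePoint.isOpen_iff_of_mem h).1 hs).2.image hj.continuous
    convert! hc.isClosed.isOpen_compl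
    ext z
    by_cases hz : z ∈ Set.range j
    · obtain ⟨u, rfl⟩ := hz
      simp [openCollapse_apply hj.injective, hj.injective.eq_iff]
    · have : ∀ u, j u ≠ z := fun u hu ↦ hz ⟨u, hu⟩
      simp [openCollapse_of_notMem hz, h, this]
  · convert! hj.isOpenMap _ ((OnePoint.isOpen_iff_of_notMem h).1 hs)
    ext z
    by_cases hz : z ∈ Set.range j
    · obtain ⟨u, rfl⟩ := hz
      simp [openCollapse_apply hj.injective, hj.injective.eq_iff]
    · have : ∀ u, j u ≠ z := fun u hu ↦ hz ⟨u, hu⟩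
      simp [openCollapse_of_notMem hz, h, this]

theorem isOpenEmbedding_sigmoid : IsOpenEmbedding unitInterval.sigmoid := by
  refine ⟨unitInterval.sigmoid_strictMono.isEmbedding_of_ordConnected ?_, ?_⟩ <;>
    rw [unitInterval.range_sigmoid]
  exacts [Set.ordConnected_Ioo, isOpen_Ioo]

/-- The open cell `ℝⁿ ↪ Iⁿ`. -/
noncomputable def cubeCell (N : Type*) : (N → ℝ) → N → I := Pi.map fun _ ↦ unitInterval.sigmoid

theorem isOpenEmbedding_cubeCell (N : Type*) [Finite N] : IsOpenEmbedding (cubeCell N) :=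
  .piMap fun _ ↦ isOpenEmbedding_sigmoid

theorem range_cubeCell (N : Type*) : Set.range (cubeCell N) = (Cube.boundary N)ᶜ := by
  ext z
  rw [cubeCell, Set.range_piMap, unitInterval.range_sigmoid]
  simp [Cube.boundary, unitInterval.pos_iff_ne_zero, unitInterval.lt_one_iff_ne_one]

end Collapse

section BasedMapsOfSphere

variable {N S B : Type*} [TopologicalSpace S] [TopologicalSpace B]

/-- The extension to the sphere `S = ℝⁿ ∪ {∞}` of a map on the cube. -/
noncomputable def sphereExtend (e : OnePoint (N → ℝ) ≃ₜ S) {b : B} (g : GenLoop N B b) (s : S) :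
    B :=
  (e.symm s).elim b fun u ↦ g (cubeCell N u)

theorem sphereExtend_infty (e : OnePoint (N → ℝ) ≃ₜ S) {b : B} (g : GenLoop N B b) :
    sphereExtend e g (e OnePoint.infty) = b := by
  simp [sphereExtend]

theorem sphereExtend_coe (e : OnePoint (N → ℝ) ≃ₜ S) {b : B} (g : GenLoop N B b) (u : N → ℝ) :
    sphereExtend e g (e u) = g (cubeCell N u) := by
  simp [sphereExtend]

variable [Finite N]

/-- The characteristic map of the cell of the sphere `S = ℝⁿ ∪ {∞}`, collapsing the boundary of
the cube. -/
noncomputable def cubeCollapse (e : OnePoint (N → ℝ) ≃ₜ S) : C(N → I, S) :=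
  ⟨e ∘ openCollapse (cubeCell N),
    e.continuous.comp (continuous_openCollapse (isOpenEmbedding_cubeCell N))⟩

theorem cubeCollapse_cubeCell (e : OnePoint (N → ℝ) ≃ₜ S) (u : N → ℝ) :
    cubeCollapse e (cubeCell N u) = e u :=
  congrArg e (openCollapse_apply (isOpenEmbedding_cubeCell N).injective u)

theorem cubeCollapse_of_mem_boundary (e : OnePoint (N → ℝ) ≃ₜ S) {z : N → I}
    (hz : z ∈ Cube.boundary N) : cubeCollapse e z = e OnePoint.infty :=
  congrArg e (openCollapse_of_notMem (by simpa [range_cubeCell] using hz))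

theorem sphereExtend_cubeCollapse (e : OnePoint (N → ℝ) ≃ₜ S) {b : B} (g : GenLoop N B b)
    (z : N → I) : sphereExtend e g (cubeCollapse e z) = g z := by
  by_cases hz : z ∈ Cube.boundary N
  · rw [cubeCollapse_of_mem_boundary e hz, sphereExtend_infty, GenLoop.boundary g z hz]
  · rw [← Set.mem_compl_iff, ← range_cubeCell] at hz
    obtain ⟨u, rfl⟩ := hz
    rw [cubeCollapse_cubeCell, sphereExtend_coe]

theorem continuous_uncurry_sphereExtend [T2Space S] (e : OnePoint (N → ℝ) ≃ₜ S) (b : B) :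
    Continuous fun p : GenLoop N B b × S ↦ sphereExtend e p.1 p.2 := by
  let q : (N → I) ⊕ Unit → S := Sum.elim (cubeCollapse e) fun _ ↦ e OnePoint.infty
  have hq : Continuous q := (cubeCollapse e).continuous.sumElim continuous_const
  have hs : Function.Surjective q := fun s ↦ by
    obtain ⟨z, rfl⟩ := e.surjective s
    induction z using OnePoint.rec with
    | infty => exact ⟨.inr (), rfl⟩
    | coe u => exact ⟨.inl (cubeCell N u), cubeCollapse_cubeCell e u⟩
  have hp := (isProperMap_id (X := GenLoop N B b)).prodMap hq.isProperMap
  have hQ := hp.isClosedMap.isQuotientMap hp.continuous (Function.surjective_id.prodMap hs)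
  rw [hQ.continuous_iff]
  let F : (GenLoop N B b × (N → I)) ⊕ (GenLoop N B b × Unit) → B :=
    Sum.elim (fun p ↦ p.1 p.2) fun _ ↦ b
  have hF : Continuous F := Continuous.sumElim (by fun_prop) continuous_const
  convert hF.comp (Homeomorph.prodSumDistrib (X := GenLoop N B b)).continuous using 1
  ext ⟨g, z | z⟩
  · exact sphereExtend_cubeCollapse e g z
  · exact sphereExtend_infty e g

/-- Based maps from a sphere are maps from the cube that are constant on its boundary. -/
noncomputable def basedMapHomeomorphGenLoop [T2Space S] (e : OnePoint (N → ℝ) ≃ₜ S) (b : B) :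
    BasedMap S (e OnePoint.infty) B b ≃ₜ GenLoop N B b where
  toFun f := ⟨f.1.comp (cubeCollapse e), fun z hz ↦
    (congrArg f.1 (cubeCollapse_of_mem_boundary e hz)).trans f.2⟩
  invFun g := ⟨⟨sphereExtend e g, (continuous_uncurry_sphereExtend e b).comp (.prodMk_right g)⟩,
    sphereExtend_infty e g⟩
  left_inv f := by
    ext s
    obtain ⟨z, rfl⟩ := e.surjective s
    induction z using OnePoint.rec with
    | infty => exact (sphereExtend_infty e _).trans f.2.symm
    | coe u => exact (sphereExtend_coe e _ u).trans (congrArg f.1 (cubeCollapse_cubeCell e u))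
  right_inv g := by
    ext z
    exact sphereExtend_cubeCollapse e g z
  continuous_toFun := Continuous.subtype_mk
    ((ContinuousMap.continuous_precomp _).comp continuous_subtype_val) _
  continuous_invFun := Continuous.subtype_mk
    (ContinuousMap.continuous_of_continuous_uncurry _ (continuous_uncurry_sphereExtend e b)) _

end BasedMapsOfSphere

section LoopsOfMaps

variable (M S X : Type*) [TopologicalSpace S] [LocallyCompactSpace S] [TopologicalSpace X] (x : X)

/-- Loops in a mapping space are maps into a loop space. -/
def genLoopContinuousMapHomeomorph :
    GenLoop M C(S, X) (.const S x) ≃ₜ C(S, GenLoop M X x) where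
  toFun p := ⟨fun s ↦ ⟨⟨fun t ↦ p t s, by fun_prop⟩, fun t ht ↦
      congrArg (fun f : C(S, X) ↦ f s) (GenLoop.boundary p t ht)⟩, Continuous.subtype_mk
        (ContinuousMap.continuous_of_continuous_uncurry _ (by dsimp; fun_prop)) _⟩
  invFun f := ⟨⟨fun t ↦ ⟨fun s ↦ f s t, by fun_prop⟩,
    ContinuousMap.continuous_of_continuous_uncurry _ (by dsimp; fun_prop)⟩, fun t ht ↦ by
      ext s
      exact GenLoop.boundary (f s) t ht⟩
  left_inv _ := rfl
  right_inv _ := rfl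
  continuous_toFun := ContinuousMap.continuous_of_continuous_uncurry _ <| Continuous.subtype_mk
    (ContinuousMap.continuous_of_continuous_uncurry _ (by dsimp; fun_prop)) _
  continuous_invFun := Continuous.subtype_mk (ContinuousMap.continuous_of_continuous_uncurry _ <|
    ContinuousMap.continuous_of_continuous_uncurry _
      (by simp only [Function.uncurry_def, ContinuousMap.coe_mk]; fun_prop)) _

end LoopsOfMaps

section Assembly

variable {X : Type*} [TopologicalSpace X]

/-- A homotopy group is the fundamental group of an iterated loop space. -/
noncomputable def homotopyGroupMulEquivFundamentalGroup (N : Type*) [DecidableEq N] [Nonempty N]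
    (x : X) : HomotopyGroup N X x ≃* FundamentalGroup
      (GenLoop {j : N // j ≠ Classical.arbitrary N} X x) GenLoop.const where
  __ := homotopyGroupEquivFundamentalGroup (Classical.arbitrary N)
  map_mul' _ _ := (homotopyGroupEquivFundamentalGroup (Classical.arbitrary N)).apply_symm_apply _

/-- Iterated fundamental groups of loop spaces depend only on the total number of variables. -/
noncomputable def fundamentalGroupGenLoopMulEquivHomotopyGroup {L M N : Type*} [DecidableEq N]
    [Nonempty N] (e : L ⊕ M ≃ {j : N // j ≠ Classical.arbitrary N}) (x : X) :
    FundamentalGroup (GenLoop L (GenLoop M X x) GenLoop.const) GenLoop.const ≃*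
      HomotopyGroup N X x :=
  (FundamentalGroup.congrOfHomeomorph
    ((GenLoop.genLoopGenLoopEquiv x).trans (GenLoop.congr x e)) rfl).trans
      (homotopyGroupMulEquivFundamentalGroup N x).symm

end Assembly

/-- For a space `X` with basepoint `x`, and `k = m + 2 ≥ 2`, `n ≥ 0`, the homotopy group
`π_k` of the space `C(Sⁿ, X)` of unbased maps (with the compact-open topology), based at
the constant map at `x`, is isomorphic to the direct product `π_{n+k}(X, x) × π_k(X, x)`. -/
theorem homotopyGroup_mappingSpace_sphere_iso_prod
    {X : Type*} [TopologicalSpace X] (x : X) (n m : ℕ) :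
    Nonempty
      (HomotopyGroup (Fin (m + 1 + 1))
          C(↥(Metric.sphere (0 : EuclideanSpace ℝ (Fin (n + 1))) 1), X)
          (ContinuousMap.const _ x) ≃*
        (HomotopyGroup (Fin (n + m + 1 + 1)) X x × HomotopyGroup (Fin (m + 1 + 1)) X x)) := by
  let M := {j : Fin (m + 1 + 1) // j ≠ Classical.arbitrary _}
  let S := Metric.sphere (0 : EuclideanSpace ℝ (Fin (n + 1))) 1
  let e : OnePoint (Fin n → ℝ) ≃ₜ S := onePointEquivSphereOfFinrankEq (by simp)
  let b : GenLoop M X x := GenLoop.const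
  have hcard : Fintype.card (Fin n ⊕ M) =
      Fintype.card {j : Fin (n + m + 1 + 1) // j ≠ Classical.arbitrary _} := by
    simp [M, Fintype.card_subtype_compl]
    lia
  let φ : HomotopyGroup (Fin (m + 1 + 1)) C(S, X) (.const S x) ≃*
      FundamentalGroup C(S, GenLoop M X x) (.const S b) :=
    (homotopyGroupMulEquivFundamentalGroup _ _).trans
      (FundamentalGroup.congrOfHomeomorph (genLoopContinuousMapHomeomorph M S X x) rfl)
  have hcomm (g g' : FundamentalGroup C(S, GenLoop M X x) (.const S b)) : g * g' = g' * g := by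
    apply φ.symm.injective
    rw [map_mul, map_mul]
    exact HomotopyGroup.commGroup.mul_comm _ _
  obtain ⟨ψ⟩ := (spherePointSqueeze (e OnePoint.infty)).nonempty_mulEquiv_prod b hcomm
  exact ⟨φ.trans <| ψ.trans <| MulEquiv.prodCongr
    ((FundamentalGroup.congrOfHomeomorph (basedMapHomeomorphGenLoop e b) rfl).trans
      (fundamentalGroupGenLoopMulEquivHomotopyGroup (Fintype.equivOfCardEq hcard) x))
    (homotopyGroupMulEquivFundamentalGroup _ _).symm⟩
end
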